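/- Let p be a prime and a, b, c, d integers with 0 ≤ b ≤ a, c ≥ 0 and d < 0. Then the sequence e ↦ S(p^e·a + c, p^e·b + d), viewed in ℤ_p, converges to 0 as e → ∞. -/

import Mathlib

/-- Stirling numbers of the second kind for integer arguments:
`S(n,k) = (1/k!) ∑_{i=0}^{k} (-1)^(k-i) C(k,i) i^n` for `n, k ≥ 0` (with `0^0 = 1`),
and `S(n,k) = 0` if `n < 0` or `k < 0`. -/
def stirling2 (n k : ℤ) : ℤ :=
  if n < 0 ∨ k < 0 then 0
  else (∑ i ∈ Finset.range (k.toNat + 1),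
      (-1 : ℤ) ^ (k.toNat - i) * (Nat.choose k.toNat i : ℤ) * (i : ℤ) ^ n.toNat)
    / (Nat.factorial k.toNat : ℤ)

open Finset PowerSeries

theorem fwdDiff_iterate_succ_id_mul (f : ℤ → ℤ) (k : ℕ) :
    ∀ y : ℤ, (fwdDiff 1)^[k + 1] (fun x => x * f x) y =
      y * (fwdDiff 1)^[k + 1] f y + (k + 1) * (fwdDiff 1)^[k] f (y + 1) := by
  induction k with
  | zero => intro y; simp [fwdDiff]; ring
  | succ k ih =>
    intro y
    rw [Function.iterate_succ_apply', fwdDiff, ih, ih, Function.iterate_succ_apply' _ (k + 1) f,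
      fwdDiff]
    have h := congrFun (Function.iterate_succ_apply' (fwdDiff (1 : ℤ)) k f) (y + 1)
    rw [fwdDiff] at h
    push_cast
    linear_combination (-(k + 1 : ℤ)) * h

theorem fwdDiff_iterate_pow_zero (n k : ℕ) :
    (fwdDiff 1)^[k] (fun x : ℤ => x ^ n) 0 = k.factorial * Nat.stirlingSecond n k := by
  induction n generalizing k with
  | zero =>
    cases k with
    | zero => simp
    | succ k =>
      have h : fwdDiff 1 (fun x : ℤ => x ^ 0) = fun _ => 0 := by ext; simp [fwdDiff]
      have h' : ∀ j : ℕ, (fwdDiff (1 : ℤ))^[j] (fun _ : ℤ => (0 : ℤ)) = fun _ => 0 := by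
        intro j
        refine Function.iterate_fixed ?_ j
        ext; simp [fwdDiff]
      rw [Function.iterate_succ_apply, h, h']
      simp
  | succ n ih =>
    cases k with
    | zero => simp
    | succ k =>
      have h := congrFun (Function.iterate_succ_apply' (fwdDiff (1 : ℤ)) k (fun x => x ^ n)) 0
      rw [fwdDiff, ih, ih] at h
      have h2 := fwdDiff_iterate_succ_id_mul (fun x => x ^ n) k 0
      simp only [← pow_succ'] at h2
      rw [h2, Nat.stirlingSecond_succ_succ]
      push_cast [Nat.factorial_succ] at h ⊢
      linear_combination (-(k + 1 : ℤ)) * h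

theorem stirling2_natCast (n k : ℕ) : stirling2 n k = Nat.stirlingSecond n k := by
  have h := fwdDiff_iterate_pow_zero n k
  rw [fwdDiff_iter_eq_sum_shift] at h
  have hk : (k.factorial : ℤ) ≠ 0 := by exact_mod_cast k.factorial_ne_zero
  have hneg : ¬ ((n : ℤ) < 0 ∨ (k : ℤ) < 0) := by omega
  rw [stirling2, if_neg hneg]
  simp only [Int.toNat_natCast]
  apply Int.ediv_eq_of_eq_mul_right hk
  rw [← h]
  simp

theorem Prime.pow_dvd_right_of_not_pow_dvd_left {R : Type*} [CommMonoidWithZero R]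
    [IsCancelMulZero R] {p : R} (hp : Prime p) {b : R} (L m : ℕ) :
    ∀ a : R, ¬ p ^ L ∣ a → p ^ (L + m) ∣ a * b → p ^ m ∣ b := by
  induction L with
  | zero => intro a ha; simp at ha
  | succ L ih =>
    intro a ha hab
    by_cases hpa : p ∣ a
    · obtain ⟨a, rfl⟩ := hpa
      refine ih a (fun h => ha ?_) ?_
      · rw [pow_succ']
        exact mul_dvd_mul_left p h
      · rw [show L + 1 + m = L + m + 1 by ring, pow_succ', mul_assoc] at hab
        exact (mul_dvd_mul_iff_left hp.ne_zero).mp hab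
    · exact (pow_dvd_pow p (by omega)).trans (hp.pow_dvd_of_dvd_mul_left _ hpa hab)

/-- The reversed falling factorial `∏_{i<k} (1 - iX)`, the inverse of the generating function of
`r ↦ S(k - 1 + r, k - 1)`. -/
noncomputable def reverseDescFactorial (k : ℕ) : ℤ⟦X⟧ := ∏ i ∈ range k, (1 - (i : ℤ⟦X⟧) * X)

theorem mk_stirlingSecond_mul_reverseDescFactorial (k : ℕ) :
    PowerSeries.mk (fun r => (Nat.stirlingSecond (k + r) k : ℤ)) * reverseDescFactorial (k + 1)
      = 1 := by
  induction k with
  | zero =>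
    ext r
    cases r <;> simp [reverseDescFactorial, coeff_one]
  | succ k ih =>
    rw [reverseDescFactorial, prod_range_succ, ← reverseDescFactorial, mul_left_comm, mul_comm]
    refine Eq.trans (congrArg (· * _) ?_) ih
    ext r
    rw [mul_sub, mul_one, map_sub, ← mul_assoc]
    cases r with
    | zero => simp [Nat.stirlingSecond_self]
    | succ r =>
      have hC : ((k + 1 : ℕ) : ℤ⟦X⟧) = C ((k + 1 : ℕ) : ℤ) := by simp
      rw [coeff_succ_mul_X, hC, coeff_mul_C, coeff_mk, coeff_mk, coeff_mk,
        show k + 1 + (r + 1) = (k + 1 + r) + 1 by ring, Nat.stirlingSecond_succ_succ,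
        show k + (r + 1) = k + 1 + r by ring]
      push_cast
      ring

theorem constantCoeff_reverseDescFactorial (k : ℕ) :
    constantCoeff (reverseDescFactorial k) = 1 := by
  simp [reverseDescFactorial, map_prod]

theorem map_reverseDescFactorial_mul (N q : ℕ) :
    PowerSeries.map (Int.castRingHom (ZMod N)) (reverseDescFactorial (N * q)) =
      PowerSeries.map (Int.castRingHom (ZMod N)) (reverseDescFactorial N) ^ q := by
  induction q with
  | zero => simp [reverseDescFactorial]
  | succ q ih =>
    rw [mul_add, mul_one, reverseDescFactorial, prod_range_add, ← reverseDescFactorial, map_mul, ih,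
      pow_succ]
    congr 1
    have hN : (N : (ZMod N)⟦X⟧) = 0 := by
      rw [← map_natCast (C (R := ZMod N)), ZMod.natCast_self, map_zero]
    simp [reverseDescFactorial, map_prod, hN]

theorem natCast_dvd_mul_coeff_pow (F : ℤ⟦X⟧) (N j : ℕ) : (N : ℤ) ∣ j * coeff j (F ^ N) := by
  cases j with
  | zero => simp
  | succ j =>
    have h := coeff_derivative (F ^ N) j
    have hC : (N : ℤ⟦X⟧) = C (N : ℤ) := by simp
    rw [derivative_pow, hC, mul_assoc, coeff_C_mul] at h
    exact ⟨_, by push_cast; rw [mul_comm, ← h]⟩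

theorem coeff_prod_one_sub_mul_X_eq_zero {R : Type*} [CommRing R] (u : ℕ → R) (l i : ℕ)
    (h : l < i) : coeff i (∏ j ∈ range l, (1 - C (u j) * X)) = 0 := by
  induction l generalizing i with
  | zero => simp [coeff_one]; omega
  | succ l ih =>
    obtain ⟨i, rfl⟩ : ∃ i', i = i' + 1 := ⟨i - 1, by omega⟩
    rw [prod_range_succ, mul_sub, mul_one, map_sub, ← mul_assoc, coeff_succ_mul_X, coeff_mul_C,
      ih _ (by omega), ih _ (by omega)]
    simp

theorem pow_dvd_stirlingSecond (p : ℕ) [Fact p.Prime] (m L q k l : ℕ)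
    (hk : k + 1 + l = p ^ m * (p ^ (L + m) * q)) (r : ℕ)
    (hr : ∀ i ≤ l, i ≤ r → ¬ p ^ L ∣ r - i) :
    (p ^ m : ℤ) ∣ Nat.stirlingSecond (k + r) k := by
  set φ := PowerSeries.map (Int.castRingHom (ZMod (p ^ m))) with hφ
  set G := reverseDescFactorial (p ^ m)
  set F := invOfUnit G 1
  have hGF : G * F = 1 := mul_invOfUnit _ _ (by simp [G, constantCoeff_reverseDescFactorial])
  set P : ℤ⟦X⟧ := ∏ j ∈ range l, (1 - C ((k + 1 + j : ℕ) : ℤ) * X)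
  set H := PowerSeries.mk (fun r => (Nat.stirlingSecond (k + r) k : ℤ))
  set M := p ^ (L + m) * q
  have h1 : H * reverseDescFactorial (p ^ m * M) = P := by
    rw [← hk, reverseDescFactorial, prod_range_add, ← reverseDescFactorial, ← mul_assoc,
      mk_stirlingSecond_mul_reverseDescFactorial, one_mul]
    simp [P]
  have h2 : φ H = φ (P * F ^ M) := by
    rw [← h1, map_mul, map_mul, map_reverseDescFactorial_mul, map_pow, mul_assoc, ← mul_pow,
      ← map_mul, hGF, map_one, one_pow, mul_one]
  have h3 : (p ^ m : ℤ) ∣ coeff r (P * F ^ M) := by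
    rw [coeff_mul]
    refine dvd_sum fun x hx => ?_
    have hx' := mem_antidiagonal.mp hx
    rcases lt_or_ge l x.1 with hl | hl
    · rw [coeff_prod_one_sub_mul_X_eq_zero _ _ _ hl, zero_mul]
      exact dvd_zero _
    · refine Dvd.dvd.mul_left ?_ _
      have hd := hr x.1 hl (by omega)
      rw [show r - x.1 = x.2 by omega] at hd
      have hM : (p ^ (L + m) : ℤ) ∣ x.2 * coeff x.2 (F ^ M) :=
        (Dvd.intro (q : ℤ) (by simp [M])).trans (natCast_dvd_mul_coeff_pow F M x.2)
      exact (Nat.prime_iff_prime_int.mp Fact.out).pow_dvd_right_of_not_pow_dvd_left L m _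
        (by exact_mod_cast hd) hM
  have h4 := congrArg (coeff r) h2
  simp only [hφ, coeff_map, H, coeff_mk] at h4
  have h5 := (ZMod.intCast_eq_intCast_iff_dvd_sub _ _ _).mp h4
  push_cast at h5
  exact (dvd_sub_right h3).mp h5

theorem padic_limit_stirling2_zero_of_d_neg (p : ℕ) [Fact p.Prime] (a b c d : ℤ)
    (hb : 0 ≤ b) (hba : b ≤ a) (hc : 0 ≤ c) (hd : d < 0) :
    Filter.Tendsto
      (fun e : ℕ => ((stirling2 ((p : ℤ) ^ e * a + c) ((p : ℤ) ^ e * b + d) : ℤ) : ℤ_[p]))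
      Filter.atTop (nhds 0) := by
  have hp : p.Prime := Fact.out
  obtain ⟨b, rfl⟩ := Int.eq_ofNat_of_zero_le hb
  obtain ⟨t, rfl⟩ : ∃ t : ℕ, a = b + t := ⟨(a - b).toNat, by omega⟩
  obtain ⟨c, rfl⟩ := Int.eq_ofNat_of_zero_le hc
  obtain ⟨l, rfl⟩ : ∃ l : ℕ, d = -(l + 1) := ⟨(-d - 1).toNat, by omega⟩
  rw [Metric.tendsto_atTop]
  intro ε hε
  obtain ⟨m, hm⟩ := PadicInt.exists_pow_neg_lt p hε
  set L := c + l + 1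
  have hL : c + l + 1 < p ^ L := Nat.lt_pow_self hp.one_lt
  refine ⟨m + (L + m), fun e he => ?_⟩
  rw [dist_zero_right]
  refine lt_of_le_of_lt (PadicInt.norm_int_le_pow_iff_dvd.mpr ?_) hm
  by_cases hk : (p : ℤ) ^ e * b + -(l + 1) < 0
  · rw [stirling2, if_pos (Or.inr hk)]
    exact dvd_zero _
  have hk' : l + 1 ≤ p ^ e * b := by zify; linarith
  obtain ⟨k, hk⟩ := Nat.exists_eq_add_of_le hk'
  have hkz : (p : ℤ) ^ e * b = l + 1 + k := by exact_mod_cast hk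
  rw [show (p : ℤ) ^ e * (b + t) + c = ((k + (p ^ e * t + L) : ℕ) : ℤ) by
      push_cast [L]; linear_combination hkz,
    show (p : ℤ) ^ e * b + -(l + 1) = (k : ℤ) by linear_combination hkz, stirling2_natCast]
  obtain ⟨s, rfl⟩ := Nat.exists_eq_add_of_le he
  refine pow_dvd_stirlingSecond p m L (p ^ s * b) k l ?_ _ ?_
  · rw [show k + 1 + l = l + 1 + k by ring, ← hk]
    ring
  · intro i hi _ hdvd
    have h1 : p ^ L ∣ p ^ (m + (L + m) + s) * t :=
      (pow_dvd_pow p (by omega)).trans (Dvd.intro _ rfl)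
    rw [Nat.add_sub_assoc (by omega), Nat.dvd_add_right h1] at hdvd
    have := Nat.le_of_dvd (by omega) hdvd
    omega
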